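/- The average number of left-to-right maxima of a uniformly random basis permutation of length n is asymptotically (ln n)/√5; precisely, (Σₚ (n−1−p)·b_{n,p}) / (Σₚ b_{n,p}) is asymptotically equivalent to (ln n)/√5 as n → ∞. (A basis permutation of length n in Bₚ has exactly n−(p+1) left-to-right maxima.) -/

import Mathlib

/-- The word `σ₁σ₂…σₙ` of a permutation of `{1,…,n}` (0-indexed). -/
def permWord {n : ℕ} (σ : Equiv.Perm (Fin n)) : List (Fin n) :=
  List.ofFn (fun i => σ i)

/-- `β` is obtained from `α` by one right-jump: one entry is removed and
reinserted at a strictly later position. -/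
def RightJump {n : ℕ} (α β : Equiv.Perm (Fin n)) : Prop :=
  ∃ (l₁ l₂ l₃ : List (Fin n)) (a : Fin n), l₂ ≠ [] ∧
    permWord α = l₁ ++ a :: (l₂ ++ l₃) ∧
    permWord β = l₁ ++ (l₂ ++ a :: l₃)

/-- `ReachIn p α β` : `β` is obtained from `α` by a sequence of exactly `p` right-jumps. -/
def ReachIn {n : ℕ} : ℕ → Equiv.Perm (Fin n) → Equiv.Perm (Fin n) → Prop
  | 0, α, β => α = β
  | p + 1, α, β => ∃ γ, RightJump α γ ∧ ReachIn p γ β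

/-- `σᵢ` is a left-to-right maximum of `σ`. -/
def IsLtrMax {n : ℕ} (σ : Equiv.Perm (Fin n)) (i : Fin n) : Prop :=
  ∀ j, j ≤ i → σ j ≤ σ i

/-- The number of non-left-to-right-maxima of `σ`. -/
noncomputable def nonLtrMaxCount {n : ℕ} (σ : Equiv.Perm (Fin n)) : ℕ :=
  {i : Fin n | ¬ IsLtrMax σ i}.ncard

/-- `π` is a pattern of `σ` (`π ≺ σ`): `σ` has a subsequence order-isomorphic to `π`. -/
def IsPattern {k n : ℕ} (π : Equiv.Perm (Fin k)) (σ : Equiv.Perm (Fin n)) : Prop :=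
  ∃ f : Fin k → Fin n, StrictMono f ∧ ∀ i j : Fin k, π i < π j ↔ σ (f i) < σ (f j)

/-- `σ ∈ Cₚ` : `σ` is obtainable from the identity by at most `p` right-jumps. -/
def InC (p : ℕ) {n : ℕ} (σ : Equiv.Perm (Fin n)) : Prop :=
  ∃ q ≤ p, ReachIn q 1 σ

/-- `σ ∈ Bₚ`, the basis of `Cₚ`: `σ ∉ Cₚ` and every pattern `π ≺ σ` with `π ≠ σ`
(equivalently, of length `≠ n`) belongs to `Cₚ`. -/
def InBasis (p : ℕ) {n : ℕ} (σ : Equiv.Perm (Fin n)) : Prop :=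
  ¬ InC p σ ∧ ∀ (k : ℕ) (π : Equiv.Perm (Fin k)), IsPattern π σ → k ≠ n → InC p π

/-- `b_{n,p}`: the number of basis permutations of length `n` in `Bₚ`. -/
noncomputable def bnp (n p : ℕ) : ℕ :=
  Nat.card {σ : Equiv.Perm (Fin n) // InBasis p σ}

def NL {n : ℕ} (l : List (Fin n)) : Set (Fin n) := {x | ∃ y, x < y ∧ [y, x].Sublist l}

theorem pair_sub_ofFn {n : ℕ} (σ : Equiv.Perm (Fin n)) (y x : Fin n) :
    [y, x].Sublist (permWord σ) ↔ ∃ j i, j < i ∧ σ j = y ∧ σ i = x := by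
  unfold permWord
  constructor
  · intro h
    rw [List.sublist_iff_exists_fin_orderEmbedding_get_eq] at h
    obtain ⟨f, hf⟩ := h
    refine ⟨(f ⟨0, by simp⟩).cast (by simp), (f ⟨1, by simp⟩).cast (by simp), ?_, ?_, ?_⟩
    · have : f ⟨0, by simp⟩ < f ⟨1, by simp⟩ := f.strictMono (by simp)
      simp
    · have := hf ⟨0, by simp⟩
      simp at this
      rw [this]; rfl
    · have := hf ⟨1, by simp⟩
      simp at this
      rw [this]; rfl
  · rintro ⟨j, i, hji, rfl, rfl⟩
    have : [σ j, σ i] = [j, i].map σ := rfl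
    rw [this, List.ofFn_eq_map]
    apply List.Sublist.map
    apply List.sublist_of_subperm_of_sortedLE
    · apply List.Nodup.subperm
      · simp [hji.ne]
      · intro a _; simp
    · simp [List.sortedLE_iff_pairwise, hji.le]
    · exact (List.sortedLT_finRange n).sortedLE

theorem NL_permWord {n : ℕ} (σ : Equiv.Perm (Fin n)) :
    NL (permWord σ) = σ '' {i | ¬ IsLtrMax σ i} := by
  ext x
  simp only [NL, Set.mem_ofPred_eq, pair_sub_ofFn, IsLtrMax, Set.mem_image]
  push Not
  constructor
  · rintro ⟨y, hxy, j, i, hji, rfl, rfl⟩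
    exact ⟨i, ⟨j, hji.le, hxy⟩, rfl⟩
  · rintro ⟨i, ⟨j, hji, h⟩, rfl⟩
    refine ⟨σ j, h, j, i, lt_of_le_of_ne hji ?_, rfl, rfl⟩
    rintro rfl
    exact lt_irrefl _ h

theorem ncard_NL {n : ℕ} (σ : Equiv.Perm (Fin n)) :
    (NL (permWord σ)).ncard = nonLtrMaxCount σ := by
  rw [NL_permWord, Set.ncard_image_of_injective _ σ.injective]; rfl

theorem permWord_nodup {n : ℕ} (σ : Equiv.Perm (Fin n)) : (permWord σ).Nodup :=
  List.nodup_ofFn.2 σ.injective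

theorem exists_permWord {n : ℕ} (l : List (Fin n)) (h : l.Nodup) (hl : l.length = n) :
    ∃ σ : Equiv.Perm (Fin n), permWord σ = l := by
  refine ⟨Equiv.ofBijective (fun i => l.get (i.cast hl.symm)) ?_, ?_⟩
  · rw [← Finite.injective_iff_bijective]
    intro i j hij
    have := List.nodup_iff_injective_get.1 h hij
    simpa using this
  · unfold permWord
    apply List.ext_get
    · simp [hl]
    · intro i h1 h2
      simp

theorem pair_sub_erase {α : Type*} {y x a : α} (l₁ l₂ : List α) (hy : y ≠ a) (hx : x ≠ a)
    (h : [y, x].Sublist (l₁ ++ a :: l₂)) : [y, x].Sublist (l₁ ++ l₂) := by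
  classical
  have := h.filter (fun z => decide (z ≠ a))
  simp only [List.filter_append] at this
  have e1 : List.filter (fun z => decide (z ≠ a)) [y, x] = [y, x] := by simp [hy, hx]
  have e2 : List.filter (fun z => decide (z ≠ a)) (a :: l₂)
      = List.filter (fun z => decide (z ≠ a)) l₂ := by simp
  rw [e1, e2] at this
  exact this.trans (List.Sublist.append List.filter_sublist List.filter_sublist)

theorem pair_sub_left {α : Type*} {x a : α} {l₁ l₂ : List α} (hn : (l₁ ++ a :: l₂).Nodup)
    (h : [a, x].Sublist (l₁ ++ a :: l₂)) : x ∈ l₂ := by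
  have ha : a ∉ l₁ := by
    intro h1
    exact (List.nodup_append.1 hn).2.2 a h1 a (by simp) rfl
  clear hn
  induction l₁ with
  | nil => simp at h; exact h
  | cons b l ih =>
    simp at ha
    apply ih _ ha.2
    rw [List.cons_append] at h
    cases h with
    | cons _ h => exact h
    | cons_cons _ h => exact absurd rfl ha.1

theorem pair_sub_right {α : Type*} {y a : α} {l₁ l₂ : List α} (hn : (l₁ ++ a :: l₂).Nodup)
    (h : [y, a].Sublist (l₁ ++ a :: l₂)) : y ∈ l₁ := by
  have h' := h.reverse
  have hn' := List.nodup_reverse.2 hn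
  simp at h' hn'
  have := pair_sub_left hn' h'
  simpa using this

theorem RightJump.le {n : ℕ} {α β : Equiv.Perm (Fin n)} (h : RightJump α β) :
    nonLtrMaxCount β ≤ nonLtrMaxCount α + 1 := by
  obtain ⟨l₁, l₂, l₃, a, hl, h1, h2⟩ := h
  rw [← ncard_NL, ← ncard_NL]
  refine le_trans (Set.ncard_le_ncard (t := insert a (NL (permWord α))) ?_ (Set.toFinite _))
    (Set.ncard_insert_le _ _)
  rintro x ⟨y, hxy, hs⟩
  by_cases hxa : x = a
  · simp [hxa]
  right
  refine ⟨y, hxy, ?_⟩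
  have hn := permWord_nodup β
  rw [h2, ← List.append_assoc] at hs hn
  rw [h1]
  by_cases hya : y = a
  · subst hya
    have := pair_sub_left hn hs
    refine List.Sublist.trans ?_ (List.sublist_append_right _ _)
    simp [this]
  · have := pair_sub_erase _ _ hya hxa hs
    rw [List.append_assoc] at this
    exact this.trans (List.Sublist.append (List.Sublist.refl _) (List.sublist_cons_self _ _))

theorem ReachIn.le {n : ℕ} {p : ℕ} {α β : Equiv.Perm (Fin n)} (h : ReachIn p α β) :
    nonLtrMaxCount β ≤ nonLtrMaxCount α + p := by
  induction p generalizing α with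
  | zero => simp [ReachIn] at h; simp [h]
  | succ p ih =>
    obtain ⟨γ, h1, h2⟩ := h
    have := ih h2
    have := h1.le
    omega

theorem ReachIn.snoc {n : ℕ} {p : ℕ} {α γ β : Equiv.Perm (Fin n)} (h : ReachIn p α γ)
    (h' : RightJump γ β) : ReachIn (p + 1) α β := by
  induction p generalizing α with
  | zero => simp [ReachIn] at h; subst h; exact ⟨β, h', rfl⟩
  | succ p ih =>
    obtain ⟨δ, h1, h2⟩ := h
    exact ⟨δ, h1, ih h2⟩

theorem exists_leftJump {n : ℕ} (σ : Equiv.Perm (Fin n)) (h : 0 < nonLtrMaxCount σ) :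
    ∃ γ, RightJump γ σ ∧ nonLtrMaxCount γ < nonLtrMaxCount σ := by
  rw [← ncard_NL, Set.ncard_pos] at h
  obtain ⟨a, y, hay, hs⟩ := h
  have hmem : a ∈ permWord σ := hs.subset (by simp)
  obtain ⟨s, l₃, hsl⟩ := List.append_of_mem hmem
  have hn := permWord_nodup σ
  have hlen : (permWord σ).length = n := by simp [permWord]
  have hs' := hs
  rw [hsl] at hs hn hlen
  have hys := pair_sub_right hn hs
  obtain ⟨l₁, h₀, l₂, rfl, hl1, hh⟩ : ∃ l₁ h₀ l₂, s = l₁ ++ h₀ :: l₂ ∧ (∀ z ∈ l₁, z < a) ∧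
      a < h₀ := by
    have hne : a ∉ s := by
      intro h1
      exact (List.nodup_append.1 hn).2.2 a h1 a (by simp) rfl
    clear hs hs' hn hlen hmem hsl
    induction s with
    | nil => simp at hys
    | cons b s ih =>
      by_cases hb : a < b
      · exact ⟨[], b, s, rfl, by simp, hb⟩
      · by_cases hba : b = a
        · exact absurd hne (by simp [hba])
        · have : y ∈ s := by
            rcases List.mem_cons.1 hys with rfl | h
            · exact absurd hay hb
            · exact h
          obtain ⟨l₁, h₀, l₂, rfl, h1, h2⟩ := ih this (fun h => hne (by simp [h]))
          refine ⟨b :: l₁, h₀, l₂, rfl, ?_, h2⟩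
          intro z hz
          rcases List.mem_cons.1 hz with rfl | h
          · exact lt_of_le_of_ne (not_lt.1 hb) hba
          · exact h1 z h
  have hperm : (l₁ ++ a :: (h₀ :: l₂ ++ l₃)).Perm (l₁ ++ h₀ :: l₂ ++ a :: l₃) := by
    rw [List.append_assoc]
    exact List.Perm.append_left _ List.perm_middle.symm
  have hn2 := hperm.nodup_iff.2 hn
  obtain ⟨γ, hγ⟩ := exists_permWord (l₁ ++ a :: (h₀ :: l₂ ++ l₃)) hn2
    (by rw [hperm.length_eq, hlen])
  refine ⟨γ, ⟨l₁, h₀ :: l₂, l₃, a, by simp, hγ, by rw [hsl]; simp⟩, ?_⟩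
  rw [← ncard_NL, ← ncard_NL]
  apply Set.ncard_lt_ncard _ (Set.toFinite _)
  rw [Set.ssubset_iff_of_subset]
  · refine ⟨a, ⟨y, hay, hs'⟩, ?_⟩
    rintro ⟨z, haz, hz⟩
    rw [hγ] at hz
    have := hl1 z (pair_sub_right hn2 hz)
    exact absurd haz (not_lt.2 this.le)
  · rintro x ⟨z, hxz, hz⟩
    rw [hγ] at hz
    by_cases hxa : x = a
    · subst hxa
      exact ⟨y, hay, hs'⟩
    by_cases hza : z = a
    · subst hza
      have hx := pair_sub_left hn2 hz
      refine ⟨h₀, hxz.trans hh, ?_⟩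
      rw [hsl, List.append_assoc]
      refine List.Sublist.trans ?_ (List.sublist_append_right _ _)
      have : x ≠ h₀ := (hxz.trans hh).ne
      simp [this] at hx ⊢
      tauto
    · refine ⟨z, hxz, ?_⟩
      rw [hsl]
      have := pair_sub_erase _ _ hza hxa hz
      rw [← List.append_assoc] at this
      exact this.trans (List.Sublist.append (List.Sublist.refl _) (List.sublist_cons_self _ _))

theorem eq_one_of_zero {n : ℕ} (σ : Equiv.Perm (Fin n)) (h : nonLtrMaxCount σ = 0) : 1 = σ := by
  unfold nonLtrMaxCount at h
  rw [Set.ncard_eq_zero] at h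
  have hm : StrictMono σ := by
    apply Monotone.strictMono_of_injective _ σ.injective
    intro i j hij
    have : j ∉ {i : Fin n | ¬ IsLtrMax σ i} := by rw [h]; simp
    simp at this
    exact this i hij
  have : (⇑σ) = id := by
    apply (StrictMono.range_inj hm strictMono_id).1
    simp
  ext i; simp [this]

theorem count_one (n : ℕ) : nonLtrMaxCount (1 : Equiv.Perm (Fin n)) = 0 := by
  unfold nonLtrMaxCount
  rw [Set.ncard_eq_zero]
  ext i; simp [IsLtrMax]

theorem exists_reach {n : ℕ} (k : ℕ) (σ : Equiv.Perm (Fin n)) (h : nonLtrMaxCount σ ≤ k) :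
    ∃ q ≤ k, ReachIn q 1 σ := by
  induction k generalizing σ with
  | zero => exact ⟨0, le_rfl, eq_one_of_zero σ (by omega)⟩
  | succ k ih =>
    by_cases h0 : nonLtrMaxCount σ = 0
    · exact ⟨0, by omega, eq_one_of_zero σ h0⟩
    obtain ⟨γ, h1, h2⟩ := exists_leftJump σ (by omega)
    obtain ⟨q, hq, hr⟩ := ih γ (by omega)
    exact ⟨q + 1, by omega, hr.snoc h1⟩

theorem inC_iff {n : ℕ} (p : ℕ) (σ : Equiv.Perm (Fin n)) : InC p σ ↔ nonLtrMaxCount σ ≤ p := by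
  constructor
  · rintro ⟨q, hq, h⟩
    have := h.le
    rw [count_one] at this
    omega
  · exact exists_reach p σ

def Cov {n : ℕ} (σ : Equiv.Perm (Fin n)) (j t : Fin n) : Prop :=
  j < t ∧ σ t < σ j ∧ ∀ i, i < t → i ≠ j → σ i < σ t

def GoodP {n : ℕ} (σ : Equiv.Perm (Fin n)) : Prop :=
  ∀ j, IsLtrMax σ j → ∃ t, Cov σ j t

theorem not_ltr_iff {n : ℕ} (σ : Equiv.Perm (Fin n)) (i : Fin n) :
    ¬ IsLtrMax σ i ↔ ∃ j, j < i ∧ σ i < σ j := by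
  unfold IsLtrMax
  push Not
  constructor
  · rintro ⟨j, h1, h2⟩
    refine ⟨j, lt_of_le_of_ne h1 ?_, h2⟩
    rintro rfl
    exact lt_irrefl _ h2
  · rintro ⟨j, h1, h2⟩
    exact ⟨j, h1.le, h2⟩

theorem exists_delete {k : ℕ} (σ : Equiv.Perm (Fin (k + 1))) (m : Fin (k + 1)) :
    ∃ π : Equiv.Perm (Fin k),
      ∀ i j : Fin k, π i < π j ↔ σ (m.succAbove i) < σ (m.succAbove j) := by
  have h : ∀ i : Fin k, ∃ z : Fin k, (σ m).succAbove z = σ (m.succAbove i) := by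
    intro i
    apply Fin.exists_succAbove_eq
    intro h
    exact Fin.succAbove_ne m i (σ.injective h)
  choose g hg using h
  have hinj : Function.Injective g := by
    intro i j hij
    have : σ (m.succAbove i) = σ (m.succAbove j) := by rw [← hg, ← hg, hij]
    exact Fin.succAbove_right_injective (σ.injective this)
  refine ⟨Equiv.ofBijective g (Finite.injective_iff_bijective.1 hinj), ?_⟩
  intro i j
  rw [← hg, ← hg]
  simp [Fin.succAbove_lt_succAbove_iff]

theorem inBasis_iff {n : ℕ} (p : ℕ) (σ : Equiv.Perm (Fin n)) :
    InBasis p σ ↔ nonLtrMaxCount σ = p + 1 ∧ GoodP σ := by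
  unfold InBasis
  simp only [inC_iff]
  constructor
  · rintro ⟨h1, h2⟩
    have hpos : 0 < nonLtrMaxCount σ := by omega
    obtain ⟨k, rfl⟩ : ∃ k, n = k + 1 := by
      cases n with
      | zero =>
        exfalso
        unfold nonLtrMaxCount at hpos
        rw [Set.ncard_pos] at hpos
        obtain ⟨i, _⟩ := hpos
        exact i.elim0
      | succ k => exact ⟨k, rfl⟩
    have key : ∀ m : Fin (k + 1), ∃ π : Equiv.Perm (Fin k), nonLtrMaxCount π ≤ p ∧
        ∀ i j : Fin k, π i < π j ↔ σ (m.succAbove i) < σ (m.succAbove j) := by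
      intro m
      obtain ⟨π, hπ⟩ := exists_delete σ m
      exact ⟨π, h2 k π ⟨m.succAbove, Fin.strictMono_succAbove m, hπ⟩ (by omega), hπ⟩
    -- witness lemma
    have wit : ∀ (m : Fin (k + 1)) (π : Equiv.Perm (Fin k)),
        (∀ i j : Fin k, π i < π j ↔ σ (m.succAbove i) < σ (m.succAbove j)) →
        ∀ i, (∃ j, j ≠ m ∧ j < i ∧ σ i < σ j) → i ≠ m →
        i ∈ m.succAbove '' {i | ¬ IsLtrMax π i} := by
      rintro m π hπ i ⟨j, hjm, hji, hlt⟩ him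
      obtain ⟨i, rfl⟩ := Fin.exists_succAbove_eq him
      obtain ⟨j, rfl⟩ := Fin.exists_succAbove_eq hjm
      refine ⟨i, ?_, rfl⟩
      simp only [Set.mem_ofPred_eq, not_ltr_iff]
      exact ⟨j, by simpa [Fin.succAbove_lt_succAbove_iff] using hji, (hπ _ _).2 hlt⟩
    have hcount : nonLtrMaxCount σ = p + 1 := by
      have hp := hpos
      unfold nonLtrMaxCount at hp
      rw [Set.ncard_pos] at hp
      obtain ⟨m, hm⟩ := hp
      obtain ⟨π, hc, hπ⟩ := key m
      have : nonLtrMaxCount σ ≤ nonLtrMaxCount π + 1 := by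
        unfold nonLtrMaxCount
        rw [← Set.ncard_image_of_injective {i | ¬ IsLtrMax π i}
          (Fin.succAbove_right_injective (p := m))]
        refine le_trans (Set.ncard_le_ncard ?_ (Set.toFinite _)) (Set.ncard_insert_le m _)
        intro i hi
        by_cases him : i = m
        · left; exact him
        right
        refine wit m π hπ i ?_ him
        simp only [Set.mem_ofPred_eq, not_ltr_iff] at hi hm
        obtain ⟨j, hji, hlt⟩ := hi
        by_cases hjm : j = m
        · obtain ⟨j', h3, h4⟩ := hm
          subst hjm
          exact ⟨j', h3.ne, h3.trans hji, hlt.trans h4⟩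
        · exact ⟨j, hjm, hji, hlt⟩
      omega
    refine ⟨hcount, ?_⟩
    intro m hm
    by_contra hcov
    obtain ⟨π, hc, hπ⟩ := key m
    have : nonLtrMaxCount σ ≤ nonLtrMaxCount π := by
      unfold nonLtrMaxCount
      rw [← Set.ncard_image_of_injective {i | ¬ IsLtrMax π i}
        (Fin.succAbove_right_injective (p := m))]
      refine Set.ncard_le_ncard ?_ (Set.toFinite _)
      intro i hi
      have him : i ≠ m := by rintro rfl; exact hi hm
      refine wit m π hπ i ?_ him
      by_contra hno
      apply hcov
      push Not at hno
      simp only [Set.mem_ofPred_eq, not_ltr_iff] at hi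
      obtain ⟨j, hji, hlt⟩ := hi
      have hjm : j = m := by
        by_contra hjm
        exact absurd hlt (not_lt.2 (hno j hjm hji))
      subst hjm
      refine ⟨i, hji, hlt, ?_⟩
      intro i' h3 h4
      exact lt_of_le_of_ne (hno i' h4 h3) (fun h => h3.ne (σ.injective h))
    omega
  · rintro ⟨h1, h2⟩
    refine ⟨by omega, ?_⟩
    rintro k π ⟨f, hf, hπ⟩ hk
    suffices nonLtrMaxCount π < nonLtrMaxCount σ by omega
    have hkn : k < n := by
      have := Fintype.card_le_of_injective f hf.injective
      simp at this
      omega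
    obtain ⟨m, hm⟩ : ∃ m, m ∉ Set.range f := by
      by_contra hcon
      push Not at hcon
      have := Fintype.card_le_of_surjective f hcon
      simp at this
      omega
    unfold nonLtrMaxCount
    rw [← Set.ncard_image_of_injective {i | ¬ IsLtrMax π i} hf.injective]
    apply Set.ncard_lt_ncard _ (Set.toFinite _)
    rw [Set.ssubset_iff_of_subset]
    · by_cases hl : IsLtrMax σ m
      · obtain ⟨t, h3, h4, h5⟩ := h2 m hl
        refine ⟨t, ?_, ?_⟩
        · simp only [Set.mem_ofPred_eq, not_ltr_iff]
          exact ⟨m, h3, h4⟩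
        · rintro ⟨s, hs, rfl⟩
          simp only [Set.mem_ofPred_eq, not_ltr_iff] at hs
          obtain ⟨j, hj, hlt⟩ := hs
          rw [hπ] at hlt
          have := h5 (f j) (hf hj) (fun h => hm ⟨j, h⟩)
          exact lt_asymm this hlt
      · refine ⟨m, hl, ?_⟩
        rintro ⟨s, hs, rfl⟩
        exact hm ⟨s, rfl⟩
    · rintro _ ⟨i, hi, rfl⟩
      simp only [Set.mem_ofPred_eq, not_ltr_iff] at hi ⊢
      obtain ⟨j, hj, hlt⟩ := hi
      exact ⟨f j, hf hj, (hπ _ _).1 hlt⟩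

noncomputable def ins {n : ℕ} (v : Fin (n + 1)) (σ : Equiv.Perm (Fin n)) :
    Equiv.Perm (Fin (n + 1)) :=
  Equiv.ofBijective (Fin.lastCases (motive := fun _ => Fin (n + 1)) v (fun i => v.succAbove (σ i)))
    (Finite.injective_iff_bijective.1 (by
      intro i j
      refine Fin.lastCases ?_ (fun i => ?_) i <;> refine Fin.lastCases ?_ (fun j => ?_) j
      · simp
      · simp only [Fin.lastCases_last, Fin.lastCases_castSucc]
        intro h; exact absurd h.symm (Fin.succAbove_ne _ _)
      · simp only [Fin.lastCases_last, Fin.lastCases_castSucc]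
        intro h; exact absurd h (Fin.succAbove_ne _ _)
      · simp only [Fin.lastCases_castSucc]
        intro h
        rw [σ.injective (Fin.succAbove_right_injective h)]))

@[simp] theorem ins_last {n : ℕ} (v : Fin (n + 1)) (σ : Equiv.Perm (Fin n)) :
    ins v σ (Fin.last n) = v := by simp [ins]

@[simp] theorem ins_castSucc {n : ℕ} (v : Fin (n + 1)) (σ : Equiv.Perm (Fin n)) (i : Fin n) :
    ins v σ i.castSucc = v.succAbove (σ i) := by simp [ins]

theorem ins_bij (n : ℕ) : Function.Bijective
    (fun x : Fin (n + 1) × Equiv.Perm (Fin n) => ins x.1 x.2) := by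
  rw [Fintype.bijective_iff_injective_and_card]
  constructor
  · rintro ⟨v, σ⟩ ⟨w, τ⟩ h
    simp only at h
    have hv : v = w := by
      have := congrArg (fun f => f (Fin.last n)) h
      simpa using this
    subst hv
    congr 1
    ext i
    have := congrArg (fun f => f i.castSucc) h
    simp at this
    rw [this]
  · simp [Fintype.card_perm, Nat.factorial_succ]

theorem sum_ins {n : ℕ} (F : Equiv.Perm (Fin (n + 1)) → ℝ) :
    ∑ τ, F τ = ∑ v, ∑ σ, F (ins v σ) := by
  rw [← Fintype.sum_prod_type']
  exact (Fintype.sum_bijective _ (ins_bij n) _ _ (fun _ => rfl)).symm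

theorem ltr_castSucc {n : ℕ} (v : Fin (n + 1)) (σ : Equiv.Perm (Fin n)) (i : Fin n) :
    IsLtrMax (ins v σ) i.castSucc ↔ IsLtrMax σ i := by
  unfold IsLtrMax
  constructor
  · intro h j hj
    have := h j.castSucc (by simpa using hj)
    simpa using this
  · intro h j
    refine Fin.lastCases ?_ (fun j => ?_) j
    · intro hj
      exact absurd hj (not_le.2 (Fin.castSucc_lt_last i))
    · intro hj
      simpa using h j (by simpa using hj)

theorem ltr_last {n : ℕ} (v : Fin (n + 1)) (σ : Equiv.Perm (Fin n)) :
    IsLtrMax (ins v σ) (Fin.last n) ↔ v = Fin.last n := by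
  unfold IsLtrMax
  constructor
  · intro h
    apply le_antisymm (Fin.le_last _)
    have := h ((ins v σ).symm (Fin.last n)) (Fin.le_last _)
    simpa using this
  · rintro rfl j _
    simp [Fin.le_last]

theorem cov_cc {n : ℕ} (v : Fin (n + 1)) (σ : Equiv.Perm (Fin n)) (j t : Fin n) :
    Cov (ins v σ) j.castSucc t.castSucc ↔ Cov σ j t := by
  unfold Cov
  simp only [Fin.castSucc_lt_castSucc_iff, ins_castSucc, Fin.succAbove_lt_succAbove_iff]
  refine and_congr Iff.rfl (and_congr Iff.rfl ?_)
  constructor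
  · intro h i hi hij
    simpa using h i.castSucc (by simpa using hi) (by simpa using hij)
  · intro h i
    refine Fin.lastCases ?_ (fun i => ?_) i
    · intro hj
      exact absurd hj (not_lt.2 (Fin.le_last _))
    · intro hi hij
      simpa using h i (by simpa using hi) (by simpa using hij)

theorem not_cov_last {n : ℕ} (τ : Equiv.Perm (Fin (n + 1))) (t : Fin (n + 1)) :
    ¬ Cov τ (Fin.last n) t := fun h => absurd h.1 (not_lt.2 (Fin.le_last _))

theorem cov_last {m : ℕ} (v : Fin (m + 2)) (σ : Equiv.Perm (Fin (m + 1))) (j : Fin (m + 1)) :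
    Cov (ins v σ) j.castSucc (Fin.last (m + 1)) ↔ v = (Fin.last m).castSucc ∧ σ j = Fin.last m := by
  have h0 : Cov (ins v σ) j.castSucc (Fin.last (m + 1)) ↔
      v ≤ (σ j).castSucc ∧ ∀ i, i ≠ j → (σ i).castSucc < v := by
    unfold Cov
    simp only [ins_last, ins_castSucc, Fin.lt_succAbove_iff_le_castSucc, Fin.castSucc_lt_last,
      true_and]
    refine and_congr Iff.rfl ?_
    constructor
    · intro h i hi
      have := h i.castSucc (Fin.castSucc_lt_last i) (by simpa using hi)
      rwa [ins_castSucc, Fin.succAbove_lt_iff_castSucc_lt] at this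
    · intro h i
      refine Fin.lastCases ?_ (fun i => ?_) i
      · intro hj
        exact absurd hj (lt_irrefl _)
      · intro _ hij
        rw [ins_castSucc, Fin.succAbove_lt_iff_castSucc_lt]
        exact h i (by simpa using hij)
  rw [h0]
  constructor
  · rintro ⟨h1, h2⟩
    have hj : σ j = Fin.last m := by
      by_contra hne
      have := h2 (σ.symm (Fin.last m)) (by rintro rfl; simp at hne)
      rw [Equiv.apply_symm_apply] at this
      have h3 : (σ j).castSucc ≤ (Fin.last m).castSucc := by
        simpa using Fin.le_last (σ j)
      exact absurd (this.trans_le h1) (not_lt.2 h3)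
    refine ⟨?_, hj⟩
    rw [hj] at h1
    by_contra hne
    have hlt := lt_of_le_of_ne h1 hne
    obtain ⟨x, rfl⟩ : ∃ x : Fin (m + 1), x.castSucc = v :=
      ⟨v.castPred (hlt.trans_le (Fin.le_last _)).ne, by simp⟩
    have := h2 (σ.symm x) (by
      rintro rfl
      rw [Equiv.apply_symm_apply] at hj
      rw [hj] at hlt
      exact lt_irrefl _ hlt)
    rw [Equiv.apply_symm_apply] at this
    exact lt_irrefl _ this
  · rintro ⟨rfl, hj⟩
    rw [hj]
    refine ⟨le_rfl, fun i hi => ?_⟩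
    rw [Fin.castSucc_lt_castSucc_iff]
    apply lt_of_le_of_ne (Fin.le_last _)
    rw [← hj]
    exact fun h => hi (σ.injective h)

theorem covd {m : ℕ} (v : Fin (m + 2)) (σ : Equiv.Perm (Fin (m + 1))) (j : Fin (m + 1)) :
    (∃ t, Cov (ins v σ) j.castSucc t) ↔
      (∃ t, Cov σ j t) ∨ (v = (Fin.last m).castSucc ∧ σ j = Fin.last m) := by
  rw [← cov_last]
  constructor
  · rintro ⟨t, ht⟩
    revert ht
    refine Fin.lastCases ?_ (fun t => ?_) t
    · exact fun h => Or.inr h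
    · exact fun h => Or.inl ⟨t, (cov_cc _ _ _ _).1 h⟩
  · rintro (⟨t, ht⟩ | h)
    · exact ⟨_, (cov_cc v _ _ _).2 ht⟩
    · exact ⟨_, h⟩

def QGood {m : ℕ} (σ : Equiv.Perm (Fin (m + 1))) : Prop :=
  ∀ j, IsLtrMax σ j → σ j ≠ Fin.last m → ∃ t, Cov σ j t

def Pend {m : ℕ} (σ : Equiv.Perm (Fin (m + 1))) : Prop := QGood σ ∧ ¬ GoodP σ

theorem good_top {m : ℕ} (σ : Equiv.Perm (Fin (m + 1))) : ¬ GoodP (ins (Fin.last (m + 1)) σ) := by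
  intro h
  obtain ⟨t, ht⟩ := h (Fin.last _) ((ltr_last _ _).2 rfl)
  exact not_cov_last _ _ ht

theorem pend_top {m : ℕ} (σ : Equiv.Perm (Fin (m + 1))) :
    Pend (ins (Fin.last (m + 1)) σ) ↔ GoodP σ := by
  unfold Pend
  simp only [good_top, not_false_eq_true, and_true]
  constructor
  · intro h j hj
    have := h j.castSucc ((ltr_castSucc _ _ _).2 hj) (by
      rw [ins_castSucc]; exact Fin.succAbove_ne _ _)
    rw [covd] at this
    rcases this with h | h
    · exact h
    · exact absurd h.1.symm (Fin.castSucc_lt_last _).ne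
  · intro h j
    refine Fin.lastCases ?_ (fun j => ?_) j
    · intro _ h; simp at h
    · intro hj _
      rw [ltr_castSucc] at hj
      rw [covd]
      exact Or.inl (h j hj)

theorem good_mid {m : ℕ} (σ : Equiv.Perm (Fin (m + 1))) :
    GoodP (ins (Fin.last m).castSucc σ) ↔ QGood σ := by
  constructor
  · intro h j hj hne
    have := h j.castSucc ((ltr_castSucc _ _ _).2 hj)
    rw [covd] at this
    rcases this with h | h
    · exact h
    · exact absurd h.2 hne
  · intro h j
    refine Fin.lastCases ?_ (fun j => ?_) j
    · intro hl
      rw [ltr_last] at hl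
      exact absurd hl (Fin.castSucc_lt_last _).ne
    · intro hj
      rw [ltr_castSucc] at hj
      rw [covd]
      by_cases hne : σ j = Fin.last m
      · exact Or.inr ⟨rfl, hne⟩
      · exact Or.inl (h j hj hne)

theorem succAbove_eq_last {m : ℕ} (v : Fin (m + 1)) (x : Fin (m + 1)) :
    v.castSucc.succAbove x = Fin.last (m + 1) ↔ x = Fin.last m := by
  constructor
  · intro h
    have h2 : v.castSucc.succAbove (Fin.last m) = Fin.last (m + 1) := by
      rw [Fin.succAbove_of_le_castSucc _ _ (by simpa using Fin.le_last v)]; simp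
    exact Fin.succAbove_right_injective (h.trans h2.symm)
  · rintro rfl
    rw [Fin.succAbove_of_le_castSucc _ _ (by simpa using Fin.le_last v)]; simp

theorem pend_mid {m : ℕ} (σ : Equiv.Perm (Fin (m + 1))) :
    ¬ Pend (ins (Fin.last m).castSucc σ) := by
  rintro ⟨h, hg⟩
  apply hg
  rw [good_mid]
  intro j hj hne
  have := h j.castSucc ((ltr_castSucc _ _ _).2 hj) (by
    rw [ins_castSucc, Ne, succAbove_eq_last]; exact hne)
  rw [covd] at this
  rcases this with h | h
  · exact h
  · exact absurd h.2 hne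

theorem good_low {m : ℕ} (v : Fin m) (σ : Equiv.Perm (Fin (m + 1))) :
    GoodP (ins v.castSucc.castSucc σ) ↔ GoodP σ := by
  have hv : v.castSucc.castSucc ≠ (Fin.last m).castSucc := by
    intro h; exact (Fin.castSucc_lt_last v).ne (Fin.castSucc_injective _ h)
  constructor
  · intro h j hj
    have := h j.castSucc ((ltr_castSucc _ _ _).2 hj)
    rw [covd] at this
    simpa [hv] using this
  · intro h j
    refine Fin.lastCases ?_ (fun j => ?_) j
    · intro hl
      rw [ltr_last] at hl
      exact absurd hl (Fin.castSucc_lt_last _).ne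
    · intro hj
      rw [ltr_castSucc] at hj
      rw [covd]
      exact Or.inl (h j hj)

theorem pend_low {m : ℕ} (v : Fin m) (σ : Equiv.Perm (Fin (m + 1))) :
    Pend (ins v.castSucc.castSucc σ) ↔ Pend σ := by
  have hv : v.castSucc.castSucc ≠ (Fin.last m).castSucc := by
    intro h; exact (Fin.castSucc_lt_last v).ne (Fin.castSucc_injective _ h)
  unfold Pend
  rw [good_low]
  refine and_congr ?_ Iff.rfl
  constructor
  · intro h j hj hne
    have := h j.castSucc ((ltr_castSucc _ _ _).2 hj) (by
      rw [ins_castSucc, Ne, succAbove_eq_last]; exact hne)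
    rw [covd] at this
    simpa [hv] using this
  · intro h j
    refine Fin.lastCases ?_ (fun j => ?_) j
    · intro hl
      rw [ltr_last] at hl
      exact absurd hl (Fin.castSucc_lt_last _).ne
    · intro hj hne
      rw [ltr_castSucc] at hj
      rw [ins_castSucc, Ne, succAbove_eq_last] at hne
      rw [covd]
      exact Or.inl (h j hj hne)

open Classical in
theorem count_eq_sum {n : ℕ} (σ : Equiv.Perm (Fin n)) :
    (nonLtrMaxCount σ : ℝ) = ∑ i, if IsLtrMax σ i then (0 : ℝ) else 1 := by
  unfold nonLtrMaxCount
  rw [Set.ncard_eq_toFinset_card', Finset.card_eq_sum_ones, Set.toFinset_ofPred, Finset.sum_filter]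
  push_cast
  simp [ite_not]

open Classical in
theorem count_ins {n : ℕ} (v : Fin (n + 1)) (σ : Equiv.Perm (Fin n)) :
    (nonLtrMaxCount (ins v σ) : ℝ) = nonLtrMaxCount σ + if v = Fin.last n then 0 else 1 := by
  rw [count_eq_sum, count_eq_sum, Fin.sum_univ_castSucc]
  simp only [ltr_castSucc, ltr_last]

open Classical in
noncomputable def ind (P : Prop) : ℝ := if P then 1 else 0

theorem ind_pos {P : Prop} (h : P) : ind P = 1 := by simp [ind, h]

theorem ind_neg {P : Prop} (h : ¬ P) : ind P = 0 := by simp [ind, h]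

noncomputable def SS (g : ℝ → ℝ) (m : ℕ) : ℝ :=
  ∑ σ : Equiv.Perm (Fin (m + 1)), ind (GoodP σ) * g ((m + 1 : ℝ) - nonLtrMaxCount σ)

noncomputable def TT (g : ℝ → ℝ) (m : ℕ) : ℝ :=
  ∑ σ : Equiv.Perm (Fin (m + 1)), ind (Pend σ) * g ((m + 1 : ℝ) - nonLtrMaxCount σ)

theorem GoodP.q {m : ℕ} {σ : Equiv.Perm (Fin (m + 1))} (h : GoodP σ) : QGood σ :=
  fun j hj _ => h j hj

theorem zeros_low {m : ℕ} (v : Fin (m + 1)) (σ : Equiv.Perm (Fin (m + 1))) :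
    (((m + 1 : ℕ) : ℝ) + 1) - nonLtrMaxCount (ins v.castSucc σ) =
      (m + 1 : ℝ) - nonLtrMaxCount σ := by
  rw [count_ins, if_neg (Fin.castSucc_lt_last v).ne]
  push_cast; ring

theorem zeros_top {m : ℕ} (σ : Equiv.Perm (Fin (m + 1))) :
    (((m + 1 : ℕ) : ℝ) + 1) - nonLtrMaxCount (ins (Fin.last (m + 1)) σ) =
      ((m + 1 : ℝ) - nonLtrMaxCount σ) + 1 := by
  rw [count_ins, if_pos rfl]
  push_cast; ring

theorem SS_succ (g : ℝ → ℝ) (m : ℕ) : SS g (m + 1) = (m + 1) * SS g m + TT g m := by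
  unfold SS TT
  rw [sum_ins, Fin.sum_univ_castSucc, Fin.sum_univ_castSucc]
  simp only [good_low, good_mid, ind_neg (good_top _), zeros_low]
  simp only [zero_mul, Finset.sum_const_zero, add_zero, Finset.sum_const, Finset.card_univ,
    Fintype.card_fin, nsmul_eq_mul]
  rw [add_mul, one_mul, add_assoc, ← Finset.sum_add_distrib]
  congr 1
  refine Finset.sum_congr rfl fun σ _ => ?_
  by_cases h1 : GoodP σ
  · rw [ind_pos h1, ind_pos h1.q, ind_neg (fun h : Pend σ => h.2 h1)]; ring
  · have : Pend σ ↔ QGood σ := ⟨fun h => h.1, fun h => ⟨h, h1⟩⟩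
    rw [ind_neg h1, this]; ring

theorem TT_succ (g : ℝ → ℝ) (m : ℕ) :
    TT g (m + 1) = m * TT g m + SS (fun x => g (x + 1)) m := by
  unfold SS TT
  rw [sum_ins, Fin.sum_univ_castSucc, Fin.sum_univ_castSucc]
  simp only [pend_low, ind_neg (pend_mid _), pend_top, zeros_low, zeros_top]
  simp only [zero_mul, Finset.sum_const_zero, add_zero, Finset.sum_const, Finset.card_univ,
    Fintype.card_fin, nsmul_eq_mul]

theorem not_good0 (σ : Equiv.Perm (Fin 1)) : ¬ GoodP σ := by
  intro h
  obtain ⟨t, ht⟩ := h 0 (fun j _ => by rw [Subsingleton.elim j 0])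
  have := ht.1
  exact absurd this (by rw [Subsingleton.elim t 0]; exact lt_irrefl _)

theorem SS_zero (g : ℝ → ℝ) : SS g 0 = 0 := by
  unfold SS
  simp only [ind_neg (not_good0 _), zero_mul, Finset.sum_const_zero]

theorem TT_zero (g : ℝ → ℝ) : TT g 0 = g 1 := by
  unfold TT
  have h1 : ∀ σ : Equiv.Perm (Fin (0 + 1)), σ = 1 := fun σ =>
    Subsingleton.elim (α := Equiv.Perm (Fin 1)) σ 1
  have hp : Pend (1 : Equiv.Perm (Fin (0 + 1))) :=
    ⟨fun j _ h => absurd (Subsingleton.elim (α := Fin 1) _ _) h, not_good0 _⟩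
  rw [Fintype.sum_eq_single 1 (fun σ hσ => absurd (h1 σ) hσ), ind_pos hp, count_one]
  simp

open Classical in
theorem bnp_sum (g : ℝ → ℝ) (m : ℕ) :
    ∑ p ∈ Finset.range (m + 1), g (((m + 1 : ℕ) : ℝ) - 1 - p) * (bnp (m + 1) p : ℝ) = SS g m := by
  unfold SS
  have hb : ∀ p, (bnp (m + 1) p : ℝ) = ∑ σ : Equiv.Perm (Fin (m + 1)),
      if nonLtrMaxCount σ = p + 1 ∧ GoodP σ then (1 : ℝ) else 0 := by
    intro p
    unfold bnp
    simp only [inBasis_iff]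
    rw [Nat.card_eq_fintype_card, Fintype.card_subtype, Finset.card_eq_sum_ones, Finset.sum_filter]
    push_cast
    rfl
  simp only [hb, Finset.mul_sum]
  rw [Finset.sum_comm]
  refine Finset.sum_congr rfl fun σ _ => ?_
  by_cases hg : GoodP σ
  · rw [ind_pos hg, one_mul]
    simp only [hg, and_true]
    have h1 : 0 < nonLtrMaxCount σ := by
      by_contra h0
      have h0 : nonLtrMaxCount σ = 0 := by omega
      have := eq_one_of_zero σ h0
      subst this
      obtain ⟨t, h2, h3, _⟩ := hg 0 (fun j hj => by simpa using hj)
      simp at h3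
    have h2 : nonLtrMaxCount σ ≤ m + 1 := by
      unfold nonLtrMaxCount
      refine (Set.ncard_le_card _).trans ?_
      simp
    rw [Finset.sum_eq_single (nonLtrMaxCount σ - 1)]
    · rw [if_pos (by omega), Nat.cast_sub h1]
      push_cast
      rw [mul_one]
      congr 1
      ring
    · intro b _ hb
      rw [if_neg (by omega), mul_zero]
    · intro h
      exact absurd (Finset.mem_range.2 (by omega)) h
  · rw [ind_neg hg]
    simp [hg]

open Filter Topology in
theorem analysis_core (φ ψ s : ℝ) (hs1 : 2 ≤ s) (hφ1 : 1 ≤ φ) (hφ2 : φ ≤ 2) (hψ1 : -1 ≤ ψ)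
    (hψ0 : ψ ≤ 0) (hφψ : φ - ψ = s)
    (r x w : ℕ → ℝ) (r0 : r 0 = 1) (w0 : w 0 = 1)
    (hr : ∀ m : ℕ, r (m + 1) = r m * (m + ψ) / (m + φ))
    (hx : ∀ m : ℕ, x (m + 1) = x m + (1 - r m) / s / (m + φ))
    (hw : ∀ m : ℕ, w (m + 1) = (w m * (m + ψ) + (1 - r m) / s) / (m + φ)) :
    Tendsto (fun m : ℕ => ((x m - w m) / (1 - r m)) / (Real.log ((m + 1 : ℕ) : ℝ) / s)) atTop
      (𝓝 1) := by
  have hs0 : 0 < s := by linarith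
  have rb : ∀ m : ℕ, |r (m + 1)| ≤ 1 / ((m : ℝ) + 1) := by
    intro m
    induction m with
    | zero =>
      rw [hr, r0]
      simp only [Nat.cast_zero, zero_add, one_mul, div_one]
      rw [abs_div, abs_of_pos (by linarith : (0 : ℝ) < φ), div_le_one (by linarith), abs_le]
      constructor <;> linarith
    | succ m ih =>
      rw [hr, mul_div_assoc, abs_mul]
      push_cast
      have hm : (0 : ℝ) ≤ m := m.cast_nonneg
      have h1 : |((m : ℝ) + 1 + ψ) / (m + 1 + φ)| ≤ (m + 1) / (m + 1 + 1) := by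
        rw [abs_of_nonneg (div_nonneg (by linarith) (by linarith))]
        exact div_le_div₀ (by linarith) (by linarith) (by linarith) (by linarith)
      calc _ ≤ 1 / ((m : ℝ) + 1) * ((m + 1) / (m + 1 + 1)) :=
            mul_le_mul ih h1 (abs_nonneg _) (by positivity)
        _ = _ := by field_simp
  have rb1 : ∀ m : ℕ, |r (m + 1)| ≤ 1 := fun m => (rb m).trans (by
    rw [div_le_one (by positivity)]
    have hm : (0 : ℝ) ≤ m := m.cast_nonneg
    linarith)
  have wb : ∀ m : ℕ, |w (m + 1)| ≤ 1 := by
    intro m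
    induction m with
    | zero =>
      rw [hw, r0, w0]
      simp only [Nat.cast_zero, zero_add, one_mul, sub_self, zero_div, add_zero]
      rw [abs_div, abs_of_pos (by linarith : (0 : ℝ) < φ), div_le_one (by linarith), abs_le]
      constructor <;> linarith
    | succ m ih =>
      have hm : (0 : ℝ) ≤ m := m.cast_nonneg
      rw [hw, abs_div]
      push_cast
      rw [abs_of_pos (by linarith : (0 : ℝ) < m + 1 + φ), div_le_one (by linarith)]
      have h2 : |(1 - r (m + 1)) / s| ≤ 1 := by
        rw [abs_div, abs_of_pos hs0, div_le_one hs0]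
        have := abs_le.1 (rb1 m)
        rw [abs_le]; constructor <;> linarith
      have h3 : |w (m + 1) * ((m : ℝ) + 1 + ψ)| ≤ m + 1 + ψ := by
        rw [abs_mul, abs_of_nonneg (by linarith : (0 : ℝ) ≤ m + 1 + ψ)]
        exact mul_le_of_le_one_left (by linarith) ih
      have := abs_add_le (w (m + 1) * ((m : ℝ) + 1 + ψ)) ((1 - r (m + 1)) / s)
      linarith
  -- error term
  let e : ℕ → ℝ := fun m => x m - (harmonic m : ℝ) / s
  have estep : ∀ m : ℕ, |e (m + 2) - e (m + 1)| ≤ 2 * (1 / ((m : ℝ) + 1) - 1 / (m + 2)) := by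
    intro m
    have hm : (0 : ℝ) ≤ m := m.cast_nonneg
    have e1 : e (m + 2) - e (m + 1) =
        ((1 - φ) * (1 / (m + 2)) - r (m + 1)) / (m + 1 + φ) / s := by
      simp only [e]
      rw [hx (m + 1), show m + 2 = (m + 1) + 1 from rfl, harmonic_succ]
      push_cast
      have : (m : ℝ) + 1 + φ ≠ 0 := by linarith
      have : (m : ℝ) + 2 ≠ 0 := by linarith
      have h3 : (m : ℝ) + 1 + 1 ≠ 0 := by linarith
      field_simp
      ring
    have hp2 : 0 ≤ 1 / ((m : ℝ) + 1) := by positivity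
    have h12 : 1 / ((m : ℝ) + 2) ≤ 1 / (m + 1) :=
      one_div_le_one_div_of_le (by linarith) (by linarith)
    have hn : |(1 - φ) * (1 / ((m : ℝ) + 2)) - r (m + 1)| ≤ 2 * (1 / ((m : ℝ) + 1)) := by
      have h5 : |(1 - φ) * (1 / ((m : ℝ) + 2))| ≤ 1 / ((m : ℝ) + 1) := by
        rw [abs_mul, abs_of_pos (by positivity : 0 < 1 / ((m : ℝ) + 2))]
        refine le_trans (mul_le_of_le_one_left (by positivity) ?_) h12
        rw [abs_le]; constructor <;> linarith
      have h6 := rb m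
      rw [abs_le] at h5 h6 ⊢
      constructor <;> linarith
    have e2 : 2 * (1 / ((m : ℝ) + 1) - 1 / (m + 2)) = 2 * (1 / ((m : ℝ) + 1)) / (m + 2) := by
      field_simp
      ring
    rw [e1, e2, abs_div, abs_div, abs_of_pos hs0, abs_of_pos (by linarith : 0 < (m : ℝ) + 1 + φ)]
    refine (div_le_self (by positivity) (by linarith)).trans ?_
    exact div_le_div₀ (by positivity) hn (by linarith) (by linarith)
  have ebd : ∀ m : ℕ, |e (m + 1)| ≤ |e 1| + 2 * (1 - 1 / ((m : ℝ) + 1)) := by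
    intro m
    induction m with
    | zero => simp
    | succ m ih =>
      have h1 := estep m
      have h2 := abs_sub_abs_le_abs_sub (e (m + 2)) (e (m + 1))
      push_cast
      have : (m : ℝ) + 1 + 1 = m + 2 := by ring
      rw [this]
      show |e (m + 2)| ≤ _
      linarith
  have ebd' : ∀ m : ℕ, |e (m + 1)| ≤ |e 1| + 2 := by
    intro m
    have := ebd m
    have h2 : 0 ≤ 1 / ((m : ℝ) + 1) := by positivity
    linarith
  have hlog : Tendsto (fun m : ℕ => Real.log ((m + 1 : ℕ) : ℝ)) atTop atTop :=
    Real.tendsto_log_atTop.comp (tendsto_natCast_atTop_atTop.comp (tendsto_add_atTop_nat 1))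
  have hlogi := hlog.inv_tendsto_atTop
  have hrt : Tendsto r atTop (𝓝 0) := by
    rw [← tendsto_add_atTop_iff_nat 1]
    apply squeeze_zero_norm (fun m => rb m)
    exact tendsto_one_div_add_atTop_nhds_zero_nat
  have h1 : Tendsto (fun m : ℕ => s * (e m - w m) * (Real.log ((m + 1 : ℕ) : ℝ))⁻¹) atTop (𝓝 0) := by
    refine squeeze_zero_norm' (a := fun m : ℕ => s * (|e 1| + 3) *
      (Real.log ((m + 1 : ℕ) : ℝ))⁻¹) ?_ (by simpa using hlogi.const_mul (s * (|e 1| + 3)))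
    filter_upwards [hlog.eventually_gt_atTop 0, eventually_ge_atTop 1] with m hl hm
    obtain ⟨k, rfl⟩ : ∃ k, m = k + 1 := ⟨m - 1, by omega⟩
    rw [Real.norm_eq_abs, abs_mul, abs_mul, abs_of_pos hs0, abs_of_pos (inv_pos.2 hl)]
    apply mul_le_mul_of_nonneg_right _ (inv_pos.2 hl).le
    apply mul_le_mul_of_nonneg_left _ hs0.le
    have h5 := ebd' k
    have h6 := wb k
    rw [abs_le] at h5 h6 ⊢
    constructor <;> linarith
  have h2 : Tendsto (fun m : ℕ => 1 + ((harmonic m : ℝ) - Real.log ((m + 1 : ℕ) : ℝ)) *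
      (Real.log ((m + 1 : ℕ) : ℝ))⁻¹) atTop (𝓝 (1 + Real.eulerMascheroniConstant * 0)) := by
    apply Tendsto.const_add
    apply Tendsto.mul _ hlogi
    have := Real.tendsto_harmonic_sub_log_add_one
    simpa using this
  have h3 := (h1.add h2).div (hrt.const_sub 1) (by norm_num)
  simp only [mul_zero, add_zero, zero_add, sub_zero, div_one] at h3
  refine h3.congr' ?_
  filter_upwards [hlog.eventually_gt_atTop 0] with m hm
  simp only [Pi.div_apply]
  simp only [e]
  have : Real.log ((m + 1 : ℕ) : ℝ) ≠ 0 := hm.ne'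
  by_cases hr1 : 1 - r m = 0
  · simp [hr1]
  field_simp
  ring

open Filter Topology in
theorem analysis (a b A B : ℕ → ℝ) (a0 : a 0 = 0) (b0 : b 0 = 1) (A0 : A 0 = 0) (B0 : B 0 = 1)
    (ha : ∀ m : ℕ, a (m + 1) = (m + 1) * a m + b m)
    (hb : ∀ m : ℕ, b (m + 1) = m * b m + a m)
    (hA : ∀ m : ℕ, A (m + 1) = (m + 1) * A m + B m)
    (hB : ∀ m : ℕ, B (m + 1) = m * B m + (A m + a m)) :
    Tendsto (fun m : ℕ => (A m / a m) / (Real.log ((m + 1 : ℕ) : ℝ) / √5)) atTop (𝓝 1) := by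
  obtain ⟨s, hs⟩ : ∃ s, s = √5 := ⟨_, rfl⟩
  have hsq : s ^ 2 = 5 := by rw [hs]; exact Real.sq_sqrt (by norm_num)
  have hs0 : 0 ≤ s := by rw [hs]; exact Real.sqrt_nonneg _
  have hs2 : 2 ≤ s := by nlinarith
  have hs3 : s ≤ 3 := by nlinarith
  rw [← hs]
  obtain ⟨φ, hφ⟩ : ∃ φ, φ = (1 + s) / 2 := ⟨_, rfl⟩
  obtain ⟨ψ, hψ⟩ : ∃ ψ, ψ = (1 - s) / 2 := ⟨_, rfl⟩
  have hφq : φ ^ 2 = φ + 1 := by rw [hφ]; nlinarith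
  have hψq : ψ ^ 2 = ψ + 1 := by rw [hψ]; nlinarith
  have hd : φ - ψ = s := by rw [hφ, hψ]; ring
  let U : ℕ → ℝ := fun m => φ * a m + b m
  let V : ℕ → ℝ := fun m => ψ * a m + b m
  let X : ℕ → ℝ := fun m => φ * A m + B m
  let Y : ℕ → ℝ := fun m => ψ * A m + B m
  have hU : ∀ m : ℕ, U (m + 1) = U m * (m + φ) := by
    intro m; simp only [U, ha, hb]; linear_combination (-a m) * hφq
  have hV : ∀ m : ℕ, V (m + 1) = V m * (m + ψ) := by
    intro m; simp only [V, ha, hb]; linear_combination (-a m) * hψq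
  have hX : ∀ m : ℕ, X (m + 1) = X m * (m + φ) + a m := by
    intro m; simp only [X, hA, hB]; linear_combination (-A m) * hφq
  have hY : ∀ m : ℕ, Y (m + 1) = Y m * (m + ψ) + a m := by
    intro m; simp only [Y, hA, hB]; linear_combination (-A m) * hψq
  have hφpos : ∀ m : ℕ, 0 < (m : ℝ) + φ := by
    intro m
    have hm : (0 : ℝ) ≤ m := m.cast_nonneg
    linarith
  have hUpos : ∀ m, 0 < U m := by
    intro m
    induction m with
    | zero => simp [U, a0, b0]
    | succ m ih => rw [hU]; exact mul_pos ih (hφpos m)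
  have haU : ∀ m, a m = (U m - V m) / s := by
    intro m
    rw [eq_div_iff (by linarith), ← hd]; simp only [U, V]; ring
  have hAX : ∀ m, A m = (X m - Y m) / s := by
    intro m
    rw [eq_div_iff (by linarith), ← hd]; simp only [X, Y]; ring
  have hs' : s ≠ 0 := by linarith
  have := analysis_core φ ψ s hs2 (by linarith) (by linarith) (by linarith) (by linarith) hd
    (fun m => V m / U m) (fun m => X m / U m) (fun m => Y m / U m)
    (by simp [U, V, a0, b0]) (by simp [U, Y, a0, b0, A0, B0])
    (by
      intro m
      have := (hUpos m).ne'
      have := (hφpos m).ne'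
      simp only [hU, hV]; field_simp)
    (by
      intro m
      have := (hUpos m).ne'
      have := (hφpos m).ne'
      simp only [hX, hU]; rw [haU]; field_simp)
    (by
      intro m
      have := (hUpos m).ne'
      have := (hφpos m).ne'
      simp only [hY, hU]; rw [haU]; field_simp)
  refine this.congr fun m => ?_
  have h1 := (hUpos m).ne'
  congr 1
  rw [haU, hAX, ← sub_div, div_div_div_cancel_right₀ hs', one_sub_div h1,
    div_div_div_cancel_right₀ h1]


open Asymptotics Filter in
/-- the average number of left-to-right maxima of a uniformly random basis
permutation of length `n`, namely `(Σₚ (n−1−p)·b_{n,p}) / (Σₚ b_{n,p})`, is asymptotically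
equivalent to `(ln n)/√5` (a basis permutation of length `n` in `Bₚ` has exactly
`n−(p+1)` left-to-right maxima; `b_{n,p} = 0` for `p ≥ n−1`). -/
theorem average_ltrMax_of_basis :
    (fun n : ℕ =>
        (∑ p ∈ Finset.range n, ((n : ℝ) - 1 - (p : ℝ)) * (bnp n p : ℝ)) /
          (∑ p ∈ Finset.range n, (bnp n p : ℝ))) ~[atTop]
      (fun n : ℕ => Real.log (n : ℝ) / Real.sqrt 5) := by
  have hadd : ∀ m, SS (fun x => x + 1) m = SS (fun x => x) m + SS (fun _ => 1) m := by
    intro m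
    unfold SS
    rw [← Finset.sum_add_distrib]
    refine Finset.sum_congr rfl fun σ _ => ?_
    ring
  have h := analysis (SS (fun _ => 1)) (TT (fun _ => 1)) (SS (fun x => x)) (TT (fun x => x))
    (SS_zero _) (TT_zero _) (SS_zero _) (TT_zero _) (SS_succ _) (TT_succ _) (SS_succ _)
    (fun m => by rw [TT_succ, hadd])
  have h1 : ∀ m : ℕ, ∑ p ∈ Finset.range (m + 1), (((m + 1 : ℕ) : ℝ) - 1 - (p : ℝ)) *
      (bnp (m + 1) p : ℝ) = SS (fun x => x) m := bnp_sum (fun x => x)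
  have h2 : ∀ m : ℕ, ∑ p ∈ Finset.range (m + 1), (bnp (m + 1) p : ℝ) = SS (fun _ => 1) m := by
    intro m
    rw [← bnp_sum]
    simp
  apply isEquivalent_of_tendsto_one
  rw [← tendsto_add_atTop_iff_nat 1]
  refine h.congr fun m => ?_
  simp only [Pi.div_apply]
  rw [h1, h2]
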